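/- arXiv:1107.3811 — 4 statements merged into one kernel-verified Lean document; each statement's English description precedes it below -/
import Mathlib

section
/- Let k be a positive integer. For each n, let P_{n,1}, …, P_{n,k} be probability measures on a measurable space (Ω_n, F_n), all absolutely continuous with respect to a probability measure P_n on (Ω_n, F_n), with densities X_{n,i} = dP_{n,i}/dP_n. Let Q_1, …, Q_k be probability measures on a measurable space (Y, A), all absolutely continuous with respect to a probability measure Q on (Y, A), with densities Y_i = dQ_i/dQ. Suppose the random vectors X_n = (X_{n,1}, …, X_{n,k}) converge in distribution under P_n to the random vector Y = (Y_1, …, Y_k) under Q (i.e., the pushforward of P_n under X_n converges weakly on ℝ^k to the pushforward of Q under Y). Then there exist probability kernels K_n from (Y, A) to (Ω_n, F_n) such that max_{1 ≤ i ≤ k} ‖Q_i K_n − P_{n,i}‖₁ → 0 as n → ∞. -/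
open MeasureTheory ProbabilityTheory Filter Topology

/-- Total variation distance between two measures:
`‖μ − ν‖₁ = sup { |∫ f dμ − ∫ f dν| : f measurable, |f| ≤ 1 }`. -/
noncomputable def tvDist {α : Type*} [MeasurableSpace α] (μ ν : Measure α) : ℝ :=
  ⨆ f : { f : α → ℝ // Measurable f ∧ ∀ x, |f x| ≤ 1 },
    |∫ x, f.1 x ∂μ - ∫ x, f.1 x ∂ν|

lemma abs_le_one_of_sum_eq_one {ι : Type*} [Fintype ι] {a : ι → ℝ} (h0 : ∀ j, 0 ≤ a j)
    (hs : ∑ j, a j = 1) (j : ι) : |a j| ≤ 1 := by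
  rw [abs_of_nonneg (h0 j), ← hs]
  exact Finset.single_le_sum (fun l _ => h0 l) (Finset.mem_univ j)

lemma integrable_of_abs_le_one {α : Type*} [MeasurableSpace α] (μ : Measure α)
    [IsFiniteMeasure μ] {f : α → ℝ} (hf : Measurable f) (hf1 : ∀ x, |f x| ≤ 1) :
    Integrable f μ :=
  Integrable.of_bound hf.aestronglyMeasurable 1 (Eventually.of_forall hf1)

lemma abs_integral_le_one {α : Type*} [MeasurableSpace α] (μ : Measure α)
    [IsProbabilityMeasure μ] {f : α → ℝ} (hf1 : ∀ x, |f x| ≤ 1) :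
    |∫ x, f x ∂μ| ≤ 1 := by
  simpa using norm_integral_le_of_norm_le_const (μ := μ) (f := f) (C := 1)
    (Eventually.of_forall hf1)

/-- A finite mixture, with measurable weights, of probability measures is a Markov kernel. -/
lemma exists_mixture_kernel {ι α β : Type*} [Fintype ι] [MeasurableSpace α] [MeasurableSpace β]
    (w : ι → α → ℝ) (hw : ∀ j, Measurable (w j)) (hw0 : ∀ j x, 0 ≤ w j x)
    (hsum : ∀ x, ∑ j, w j x = 1) (μ : ι → Measure β) [∀ j, IsProbabilityMeasure (μ j)] :
    ∃ K : Kernel α β, IsMarkovKernel K ∧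
      ∀ (ν : Measure α) [IsProbabilityMeasure ν] (f : β → ℝ), Measurable f → (∀ x, |f x| ≤ 1) →
        ∫ x, f x ∂(ν.bind K) = ∑ j, (∫ x, w j x ∂ν) * ∫ x, f x ∂(μ j) := by
  let K : Kernel α β :=
    { toFun := fun x => ∑ j, ENNReal.ofReal (w j x) • μ j
      measurable' := by
        refine Measure.measurable_of_measurable_coe _ fun s _ => ?_
        simp only [Measure.coe_finsetSum, Finset.sum_apply, Measure.smul_apply, smul_eq_mul]
        exact Finset.measurable_sum _ fun j _ => (hw j).ennreal_ofReal.mul_const _ }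
  have hK : ∀ x s, K x s = ∑ j, ENNReal.ofReal (w j x) * μ j s := fun x s => by
    change (∑ j, ENNReal.ofReal (w j x) • μ j) s = _
    simp
  have hw1 : ∀ j x, |w j x| ≤ 1 := fun j x =>
    abs_le_one_of_sum_eq_one (fun l => hw0 l x) (hsum x) j
  refine ⟨K, ⟨fun x => ⟨?_⟩⟩, ?_⟩
  · rw [hK]
    simp only [measure_univ, mul_one]
    rw [← ENNReal.ofReal_sum_of_nonneg fun j _ => hw0 j x, hsum, ENNReal.ofReal_one]
  · intro ν _ f hf hf1
    have hbind : ν.bind K = ∑ j, ENNReal.ofReal (∫ x, w j x ∂ν) • μ j := by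
      ext s hs
      rw [Measure.bind_apply hs K.measurable.aemeasurable]
      simp only [hK, Measure.coe_finsetSum, Finset.sum_apply, Measure.smul_apply, smul_eq_mul]
      rw [lintegral_finsetSum _ fun j _ => (hw j).ennreal_ofReal.mul_const _]
      refine Finset.sum_congr rfl fun j _ => ?_
      rw [lintegral_mul_const _ (hw j).ennreal_ofReal,
        ofReal_integral_eq_lintegral_ofReal (integrable_of_abs_le_one ν (hw j) (hw1 j))
          (Eventually.of_forall (hw0 j))]
    rw [hbind, integral_finsetSum_measure fun j _ =>
      (integrable_of_abs_le_one (μ j) hf hf1).smul_measure ENNReal.ofReal_ne_top]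
    refine Finset.sum_congr rfl fun j _ => ?_
    rw [integral_smul_measure, ENNReal.toReal_ofReal (integral_nonneg (hw0 j)), smul_eq_mul]

/-- Normalization of the measure with density `g` (arbitrary when that measure vanishes). -/
lemma exists_normalized_withDensity {α : Type*} [MeasurableSpace α] (P : Measure α)
    [IsProbabilityMeasure P] {g : α → ℝ} (hg : Measurable g) (hg0 : ∀ x, 0 ≤ g x)
    (hg1 : ∀ x, |g x| ≤ 1) :
    ∃ μ : Measure α, IsProbabilityMeasure μ ∧
      ∀ f : α → ℝ, ∫ x, g x * f x ∂P = (∫ x, g x ∂P) * ∫ x, f x ∂μ := by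
  have hint := integrable_of_abs_le_one P hg hg1
  have hp0 : 0 ≤ ∫ x, g x ∂P := integral_nonneg hg0
  rcases hp0.eq_or_lt with hp | hp
  · refine ⟨P, inferInstance, fun f => ?_⟩
    have h0 : g =ᵐ[P] 0 := (integral_eq_zero_iff_of_nonneg hg0 hint).1 hp.symm
    rw [← hp, zero_mul]
    refine integral_eq_zero_of_ae ?_
    filter_upwards [h0] with x hx
    simp [hx]
  · have hne : ENNReal.ofReal (∫ x, g x ∂P) ≠ 0 := by simpa using hp
    refine ⟨(ENNReal.ofReal (∫ x, g x ∂P))⁻¹ • P.withDensity fun x => ENNReal.ofReal (g x),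
      ⟨?_⟩, fun f => ?_⟩
    · rw [Measure.smul_apply, withDensity_apply _ MeasurableSet.univ, Measure.restrict_univ,
        ← ofReal_integral_eq_lintegral_ofReal hint (Eventually.of_forall hg0), smul_eq_mul,
        ENNReal.inv_mul_cancel hne ENNReal.ofReal_ne_top]
    · rw [integral_smul_measure, integral_withDensity_eq_integral_toReal_smul hg.ennreal_ofReal
        (by simp), ENNReal.toReal_inv, ENNReal.toReal_ofReal hp0, smul_eq_mul, ← mul_assoc,
        mul_inv_cancel₀ hp.ne', one_mul]
      exact integral_congr_ae (Eventually.of_forall fun x => by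
        simp [ENNReal.toReal_ofReal (hg0 x)])

/-- A partition of unity on a proper space: finitely many bumps of radius at most `ε`, and a
remainder `φ none` that vanishes on the ball of radius `R`. -/
lemma exists_partition_of_unity {E : Type*} [NormedAddCommGroup E] [ProperSpace E]
    {ε : ℝ} (hε : 0 < ε) (R : ℝ) :
    ∃ (m : ℕ) (c : Fin m → E) (φ : Option (Fin m) → BoundedContinuousFunction E ℝ),
      (∀ j x, 0 ≤ φ j x) ∧ (∀ x, ∑ j, φ j x = 1) ∧ (∀ x, ‖x‖ ≤ R → φ none x = 0) ∧
      ∀ j x, φ (some j) x ≠ 0 → dist x (c j) ≤ ε := by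
  obtain ⟨t, htf, htc⟩ := Metric.totallyBounded_iff.1
    (isCompact_closedBall (0 : E) R).totallyBounded (ε / 2) (by positivity)
  obtain ⟨m, c, rfl⟩ := htf.fin_param.imp fun m h => h.imp fun c h => h.2
  let ψ : Fin m → E → ℝ := fun j x => max 0 (ε - dist x (c j))
  let S : E → ℝ := fun x => max (∑ j, ψ j x) (ε / 2)
  have hψ0 : ∀ j x, 0 ≤ ψ j x := fun j x => le_max_left _ _
  have hψc : ∀ j, Continuous (ψ j) := fun j => by fun_prop
  have hSc : Continuous S := by fun_prop
  have hS : ∀ x, 0 < S x := fun x => lt_max_of_lt_right (by positivity)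
  have hq0 : ∀ j x, 0 ≤ ψ j x / S x := fun j x => div_nonneg (hψ0 j x) (hS x).le
  have hqs : ∀ x, ∑ j, ψ j x / S x ≤ 1 := fun x => by
    rw [← Finset.sum_div, div_le_one (hS x)]
    exact le_max_left _ _
  let φ : Option (Fin m) → BoundedContinuousFunction E ℝ
    | none => BoundedContinuousFunction.ofNormedAddCommGroup (fun x => 1 - ∑ j, ψ j x / S x)
        (continuous_const.sub <| continuous_finsetSum _ fun j _ =>
          (hψc j).div hSc fun x => (hS x).ne') 1 fun x => by
          have h0 : 0 ≤ ∑ j, ψ j x / S x := Finset.sum_nonneg fun j _ => hq0 j x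
          rw [Real.norm_eq_abs, abs_le]
          constructor <;> linarith [hqs x]
    | some j => BoundedContinuousFunction.ofNormedAddCommGroup (fun x => ψ j x / S x)
        ((hψc j).div hSc fun x => (hS x).ne') 1 fun x => by
          rw [Real.norm_of_nonneg (hq0 j x)]
          exact (Finset.single_le_sum (fun l _ => hq0 l x) (Finset.mem_univ j)).trans (hqs x)
  have hnone : ∀ x, φ none x = 1 - ∑ j, ψ j x / S x := fun _ => rfl
  have hsome : ∀ j x, φ (some j) x = ψ j x / S x := fun _ _ => rfl
  refine ⟨m, c, φ, ?_, ?_, ?_, ?_⟩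
  · rintro (_ | j) x
    · rw [hnone]; linarith [hqs x]
    · exact hq0 j x
  · intro x
    simp [Fintype.sum_option, hnone, hsome]
  · intro x hx
    have hmem := htc (mem_closedBall_zero_iff.2 hx)
    simp only [Set.mem_iUnion, Metric.mem_ball, Set.mem_range, exists_prop,
      exists_exists_eq_and] at hmem
    obtain ⟨j, hj⟩ := hmem
    have h1 : ε / 2 ≤ ψ j x := le_max_of_le_right (by linarith)
    have h2 : ψ j x ≤ ∑ l, ψ l x :=
      Finset.single_le_sum (fun l _ => hψ0 l x) (Finset.mem_univ j)
    have hSx : S x = ∑ l, ψ l x := max_eq_left (h1.trans h2)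
    rw [hnone, ← Finset.sum_div, ← hSx, div_self (hS x).ne', sub_self]
  · intro j x hne
    by_contra! hlt
    exact hne (by rw [hsome, show ψ j x = 0 from max_eq_left (by linarith), zero_div])

/-- If the density of `ν` is within `ε` of `c` where `g ≠ 0`, then `g • ν` is within
`ε ∫ g ∂P` of `c • g • P`. -/
lemma abs_integral_withDensity_sub_le {α : Type*} [MeasurableSpace α] (P : Measure α)
    [IsProbabilityMeasure P] {d : α → ℝ} (hd : Measurable d) (ν : Measure α)
    [IsProbabilityMeasure ν] (hν : ν = P.withDensity fun x => ENNReal.ofReal (d x))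
    {g : α → ℝ} (hg : Measurable g) (hg0 : ∀ x, 0 ≤ g x) (hg1 : ∀ x, |g x| ≤ 1) {c ε : ℝ}
    (hgc : ∀ x, g x ≠ 0 → |max (d x) 0 - c| ≤ ε)
    {f : α → ℝ} (hf : Measurable f) (hf1 : ∀ x, |f x| ≤ 1) :
    |∫ x, g x * f x ∂ν - c * ∫ x, g x * f x ∂P| ≤ ε * ∫ x, g x ∂P := by
  have hgf1 : ∀ x, |g x * f x| ≤ 1 := fun x => by
    rw [abs_mul]; exact mul_le_one₀ (hg1 x) (abs_nonneg _) (hf1 x)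
  have hintν : Integrable (fun x => g x * f x) ν := integrable_of_abs_le_one ν (hg.mul hf) hgf1
  have hintP : Integrable (fun x => g x * f x) P := integrable_of_abs_le_one P (hg.mul hf) hgf1
  rw [hν, integrable_withDensity_iff_integrable_smul' hd.ennreal_ofReal (by simp)] at hintν
  rw [hν, integral_withDensity_eq_integral_toReal_smul hd.ennreal_ofReal (by simp),
    ← integral_const_mul, ← integral_sub hintν (hintP.const_mul c), ← integral_const_mul,
    ← Real.norm_eq_abs]
  refine norm_integral_le_of_norm_le ((integrable_of_abs_le_one P hg hg1).const_mul ε)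
    (Eventually.of_forall fun x => ?_)
  rw [ENNReal.toReal_ofReal', smul_eq_mul, ← sub_mul, Real.norm_eq_abs, abs_mul, abs_mul,
    abs_of_nonneg (hg0 x)]
  by_cases hx : g x = 0
  · simp [hx]
  · exact mul_le_mul (hgc x hx) (mul_le_of_le_one_right (hg0 x) (hf1 x))
      (mul_nonneg (hg0 x) (abs_nonneg _)) ((abs_nonneg _).trans (hgc x hx))

lemma abs_mixture_sub_sum_le {m : ℕ} {ε : ℝ} (hε : 0 ≤ ε) {p q pd qd M A : Option (Fin m) → ℝ}
    {c : Fin m → ℝ} (hp0 : 0 ≤ p none) (hq0 : 0 ≤ q none)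
    (hqd0 : 0 ≤ qd none)
    (hp : ∑ j, p j = 1) (hq : ∑ j, q j = 1) (hpd : ∑ j, pd j = 1) (hqd : ∑ j, qd j = 1)
    (hM : ∀ j, |M j| ≤ 1) (hAnone : |A none| ≤ pd none)
    (hA : ∀ j, |A (some j) - c j * (p (some j) * M (some j))| ≤ ε * p (some j))
    (hpdc : ∀ j, |pd (some j) - c j * p (some j)| ≤ ε * p (some j))
    (hqdc : ∀ j, |qd (some j) - c j * q (some j)| ≤ ε * q (some j)) :
    |∑ j, qd j * M j - ∑ j, A j| ≤
      2 * qd none + 4 * ε + 2 * ∑ j, |c j| * |p (some j) - q (some j)| := by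
  set t : Fin m → ℝ := fun j =>
    ε * q (some j) + ε * p (some j) + |c j| * |p (some j) - q (some j)| with ht
  have hcp : ∀ j, |qd (some j) - c j * p (some j)| ≤
      ε * q (some j) + |c j| * |p (some j) - q (some j)| := fun j => by
    rw [← abs_mul]
    calc |qd (some j) - c j * p (some j)|
        = |(qd (some j) - c j * q (some j)) - c j * (p (some j) - q (some j))| := by
          congr 1; ring
      _ ≤ _ := (abs_sub _ _).trans (add_le_add (hqdc j) le_rfl)
  have hdiff : ∀ j, |qd (some j) * M (some j) - A (some j)| ≤ t j := fun j => by
    have h1 : |(qd (some j) - c j * p (some j)) * M (some j)| ≤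
        |qd (some j) - c j * p (some j)| := by
      rw [abs_mul]; exact mul_le_of_le_one_right (abs_nonneg _) (hM _)
    calc |qd (some j) * M (some j) - A (some j)|
        = |(qd (some j) - c j * p (some j)) * M (some j) -
            (A (some j) - c j * (p (some j) * M (some j)))| := by congr 1; ring
      _ ≤ _ := abs_sub _ _
      _ ≤ t j := by simp only [ht]; linarith [hcp j, hA j]
  have hmass : ∀ j, qd (some j) - pd (some j) ≤ t j := fun j => by
    simp only [ht]
    linarith [le_of_abs_le (hcp j), neg_le_of_abs_le (hpdc j)]
  have hsumt : ∑ j, t j ≤ 2 * ε + ∑ j, |c j| * |p (some j) - q (some j)| := by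
    simp only [ht, Finset.sum_add_distrib, ← Finset.mul_sum]
    rw [Fintype.sum_option] at hp hq
    nlinarith
  have hpdnone : pd none ≤ qd none + ∑ j, t j := by
    have := Finset.sum_le_sum fun j (_ : j ∈ Finset.univ) => hmass j
    rw [Finset.sum_sub_distrib] at this
    rw [Fintype.sum_option] at hpd hqd
    linarith
  have hnone : |qd none * M none - A none| ≤ qd none + pd none := by
    refine (abs_sub _ _).trans (add_le_add ?_ hAnone)
    rw [abs_mul, abs_of_nonneg hqd0]
    exact mul_le_of_le_one_right hqd0 (hM _)
  have hsum : |∑ j, (qd (some j) * M (some j) - A (some j))| ≤ ∑ j, t j :=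
    (Finset.abs_sum_le_sum_abs _ _).trans (Finset.sum_le_sum fun j _ => hdiff j)
  rw [← Finset.sum_sub_distrib, Fintype.sum_option]
  linarith [abs_add_le (qd none * M none - A none)
    (∑ j, (qd (some j) * M (some j) - A (some j)))]

lemma sum_integral_comp_eq_one {ι α E : Type*} [Fintype ι] [MeasurableSpace α]
    [TopologicalSpace E] [MeasurableSpace E] [OpensMeasurableSpace E]
    {φ : ι → BoundedContinuousFunction E ℝ} (hφ0 : ∀ j x, 0 ≤ φ j x) (hφs : ∀ x, ∑ j, φ j x = 1)
    (ν : Measure α) [IsProbabilityMeasure ν] {Z : α → E} (hZ : Measurable Z) :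
    ∑ j, ∫ a, φ j (Z a) ∂ν = 1 := by
  have hφ1 : ∀ j x, |φ j x| ≤ 1 := fun j x =>
    abs_le_one_of_sum_eq_one (fun l => hφ0 l x) (hφs x) j
  rw [← integral_finsetSum _ fun j _ => integrable_of_abs_le_one (f := fun a => φ j (Z a)) ν
    ((φ j).continuous.measurable.comp hZ) fun a => hφ1 j (Z a)]
  simp [hφs]

/-- The kernel attached to a partition of unity on the space of density vectors, with a bound on
the total variation error. -/
lemma exists_kernel_tvDist_le {k m : ℕ} {Ω 𝓨 : Type*} [MeasurableSpace Ω] [MeasurableSpace 𝓨]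
    (P : Measure Ω) [IsProbabilityMeasure P]
    (Pi : Fin k → Measure Ω) [∀ i, IsProbabilityMeasure (Pi i)]
    (Q : Measure 𝓨) [IsProbabilityMeasure Q]
    (Qi : Fin k → Measure 𝓨) [∀ i, IsProbabilityMeasure (Qi i)]
    {X : Ω → EuclideanSpace ℝ (Fin k)} (hX : Measurable X)
    {Y : 𝓨 → EuclideanSpace ℝ (Fin k)} (hY : Measurable Y)
    (hPdens : ∀ i, Pi i = P.withDensity fun ω => ENNReal.ofReal (X ω i))
    (hQdens : ∀ i, Qi i = Q.withDensity fun y => ENNReal.ofReal (Y y i))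
    {ε : ℝ} (hε : 0 ≤ ε) {c : Fin m → EuclideanSpace ℝ (Fin k)}
    {φ : Option (Fin m) → BoundedContinuousFunction (EuclideanSpace ℝ (Fin k)) ℝ}
    (hφ0 : ∀ j x, 0 ≤ φ j x) (hφs : ∀ x, ∑ j, φ j x = 1)
    (hφc : ∀ j x, φ (some j) x ≠ 0 → dist x (c j) ≤ ε) :
    ∃ K : Kernel 𝓨 Ω, IsMarkovKernel K ∧ ∀ i, tvDist ((Qi i).bind K) (Pi i) ≤
      2 * ∫ y, φ none (Y y) ∂(Qi i) + 4 * ε + 2 * ∑ j, |max (c j i) 0| *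
        |∫ ω, φ (some j) (X ω) ∂P - ∫ y, φ (some j) (Y y) ∂Q| := by
  have hφ1 : ∀ j x, |φ j x| ≤ 1 := fun j x =>
    abs_le_one_of_sum_eq_one (fun l => hφ0 l x) (hφs x) j
  have hφX : ∀ j, Measurable fun ω => φ j (X ω) := fun j => (φ j).continuous.measurable.comp hX
  have hφY : ∀ j, Measurable fun y => φ j (Y y) := fun j => (φ j).continuous.measurable.comp hY
  choose μ hμ hμf using fun j => exists_normalized_withDensity P (hφX j)
    (fun ω => hφ0 j (X ω)) (fun ω => hφ1 j (X ω))
  obtain ⟨K, hK, hKf⟩ := exists_mixture_kernel (fun j y => φ j (Y y)) hφY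
    (fun j y => hφ0 j (Y y)) (fun y => hφs (Y y)) μ
  have hcoord : ∀ i j x, φ (some j) x ≠ 0 → |max (x i) 0 - max (c j i) 0| ≤ ε :=
    fun i j x hx => by
      refine (abs_max_sub_max_le_abs _ _ _).trans (le_trans ?_ (hφc j x hx))
      rw [dist_eq_norm]
      exact PiLp.norm_apply_le (x - c j) i
  have hXi : ∀ i, Measurable fun ω => X ω i := fun i => by fun_prop
  have hYi : ∀ i, Measurable fun y => Y y i := fun i => by fun_prop
  refine ⟨K, hK, fun i => Real.iSup_le (fun ⟨f, hf, hf1⟩ => ?_) ?_⟩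
  · have hφf1 : ∀ j ω, |φ j (X ω) * f ω| ≤ 1 := fun j ω => by
      rw [abs_mul]; exact mul_le_one₀ (hφ1 j _) (abs_nonneg _) (hf1 ω)
    have hdecomp : ∫ ω, f ω ∂(Pi i) = ∑ j, ∫ ω, φ j (X ω) * f ω ∂(Pi i) := by
      rw [← integral_finsetSum _ fun j _ =>
        integrable_of_abs_le_one (f := fun ω => φ j (X ω) * f ω) (Pi i) ((hφX j).mul hf) (hφf1 j)]
      simp [← Finset.sum_mul, hφs]
    rw [hKf (Qi i) f hf hf1, hdecomp]
    refine abs_mixture_sub_sum_le hε (p := fun j => ∫ ω, φ j (X ω) ∂P)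
      (q := fun j => ∫ y, φ j (Y y) ∂Q) (pd := fun j => ∫ ω, φ j (X ω) ∂(Pi i))
      (qd := fun j => ∫ y, φ j (Y y) ∂(Qi i)) (integral_nonneg fun _ => hφ0 _ _)
      (integral_nonneg fun _ => hφ0 _ _)
      (integral_nonneg fun _ => hφ0 _ _) (sum_integral_comp_eq_one hφ0 hφs P hX)
      (sum_integral_comp_eq_one hφ0 hφs Q hY) (sum_integral_comp_eq_one hφ0 hφs (Pi i) hX)
      (sum_integral_comp_eq_one hφ0 hφs (Qi i) hY) (fun j => abs_integral_le_one (μ j) hf1)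
      ?_ ?_ ?_ ?_
    · rw [← Real.norm_eq_abs]
      refine norm_integral_le_of_norm_le (integrable_of_abs_le_one (Pi i) (hφX none)
        fun ω => hφ1 _ _) (Eventually.of_forall fun ω => ?_)
      rw [Real.norm_eq_abs, abs_mul, abs_of_nonneg (hφ0 _ _)]
      exact mul_le_of_le_one_right (hφ0 _ _) (hf1 ω)
    · intro j
      rw [← hμf]
      exact abs_integral_withDensity_sub_le P (hXi i) (Pi i) (hPdens i) (hφX _)
        (fun ω => hφ0 _ _) (fun ω => hφ1 _ _) (fun ω => hcoord i j (X ω)) hf hf1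
    · intro j
      simpa using abs_integral_withDensity_sub_le P (hXi i) (Pi i) (hPdens i) (hφX (some j))
        (fun ω => hφ0 _ _) (fun ω => hφ1 _ _) (fun ω => hcoord i j (X ω))
        (f := fun _ => 1) measurable_const (by simp)
    · intro j
      simpa using abs_integral_withDensity_sub_le Q (hYi i) (Qi i) (hQdens i) (hφY (some j))
        (fun ω => hφ0 _ _) (fun ω => hφ1 _ _) (fun y => hcoord i j (Y y))
        (f := fun _ => 1) measurable_const (by simp)
  · have h0 : 0 ≤ ∫ y, φ none (Y y) ∂(Qi i) := integral_nonneg fun _ => hφ0 _ _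
    positivity

/-- Finitely many finite measures are simultaneously tight along a measurable map. -/
lemma exists_radius_measureReal_lt {ι α E : Type*} [Finite ι] [MeasurableSpace α]
    [NormedAddCommGroup E] [MeasurableSpace E] [OpensMeasurableSpace E]
    (ν : ι → Measure α) [∀ i, IsFiniteMeasure (ν i)] {Y : α → E} (hY : Measurable Y)
    {ε : ℝ} (hε : 0 < ε) :
    ∃ R : ℝ, ∀ i, (ν i).real {y | R < ‖Y y‖} < ε := by
  have key : ∀ i, Tendsto (fun n : ℕ => (ν i).real {y | (n : ℝ) < ‖Y y‖}) atTop (𝓝 0) := by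
    intro i
    have hlim := tendsto_measure_iInter_atTop (μ := ν i) (s := fun n : ℕ => {y | (n : ℝ) < ‖Y y‖})
      (fun n => (measurableSet_lt measurable_const hY.norm).nullMeasurableSet)
      (fun a b hab y (hy : (b : ℝ) < ‖Y y‖) =>
        lt_of_le_of_lt (Nat.cast_le.2 hab : (a : ℝ) ≤ b) hy)
      ⟨0, measure_ne_top _ _⟩
    have hempty : ⋂ n : ℕ, {y | (n : ℝ) < ‖Y y‖} = ∅ := by
      ext y
      simpa using (exists_nat_ge ‖Y y‖)
    rw [hempty, measure_empty] at hlim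
    exact (ENNReal.tendsto_toReal ENNReal.zero_ne_top).comp hlim
  obtain ⟨n, hn⟩ := (eventually_all.2 fun i => (key i).eventually_lt_const hε).exists
  exact ⟨n, hn⟩

/-- Choosing near-minimizers turns eventual `δ`-approximability into a sequence tending to `0`. -/
lemma exists_seq_tendsto_zero {S : ℕ → Type*} (p : ∀ n, S n → Prop) (d : ∀ n, S n → ℝ)
    (hd : ∀ n s, 0 ≤ d n s) (hne : ∀ n, ∃ s, p n s)
    (h : ∀ δ > 0, ∀ᶠ n in atTop, ∃ s, p n s ∧ d n s ≤ δ) :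
    ∃ s : ∀ n, S n, (∀ n, p n (s n)) ∧ Tendsto (fun n => d n (s n)) atTop (𝓝 0) := by
  have hbdd : ∀ n, BddBelow (Set.image (d n) {s | p n s}) := fun n =>
    ⟨0, by rintro _ ⟨s, _, rfl⟩; exact hd n s⟩
  have hchoose : ∀ n : ℕ, ∃ s, p n s ∧
      d n s < sInf (Set.image (d n) {s | p n s}) + 1 / ((n : ℝ) + 1) := by
    intro n
    obtain ⟨s₀, hs₀⟩ := hne n
    obtain ⟨_, ⟨s, hs, rfl⟩, hlt⟩ := exists_lt_of_csInf_lt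
      (⟨_, s₀, hs₀, rfl⟩ : (Set.image (d n) {s | p n s}).Nonempty)
      (lt_add_of_pos_right _ (Nat.one_div_pos_of_nat (α := ℝ) (n := n)))
    exact ⟨s, hs, hlt⟩
  choose s hps hs using hchoose
  refine ⟨s, hps, tendsto_order.2 ⟨fun a ha => Eventually.of_forall fun n =>
    ha.trans_le (hd n _), fun a ha => ?_⟩⟩
  filter_upwards [h (a / 2) (by positivity),
    tendsto_one_div_add_atTop_nhds_zero_nat.eventually_lt_const (half_pos ha)]
    with n ⟨s', hps', hs'⟩ hn
  linarith [hs n, csInf_le (hbdd n) ⟨s', hps', rfl⟩]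

/-- **Lemma 1 (first assertion, `𝒫ₙ ⊂ 𝒬` direction).**  If the vectors of densities
`Xₙ = (dPₙ,ᵢ/dPₙ)ᵢ` converge in distribution (under `Pₙ`) to the vector of densities
`Y = (dQᵢ/dQ)ᵢ` (under `Q`), then there are Markov kernels `Kₙ` from `𝓨` to `Ωₙ` with
`maxᵢ ‖Qᵢ Kₙ − Pₙ,ᵢ‖₁ → 0`. -/
theorem statement0 {k : ℕ} (hk : 0 < k)
    {Ω : ℕ → Type*} [∀ n, MeasurableSpace (Ω n)]
    {𝓨 : Type*} [MeasurableSpace 𝓨]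
    (P : (n : ℕ) → Measure (Ω n)) [∀ n, IsProbabilityMeasure (P n)]
    (Pi : (n : ℕ) → Fin k → Measure (Ω n)) [∀ n i, IsProbabilityMeasure (Pi n i)]
    (Q : Measure 𝓨) [IsProbabilityMeasure Q]
    (Qi : Fin k → Measure 𝓨) [∀ i, IsProbabilityMeasure (Qi i)]
    (X : (n : ℕ) → Ω n → EuclideanSpace ℝ (Fin k)) (hX : ∀ n, Measurable (X n))
    (Yd : 𝓨 → EuclideanSpace ℝ (Fin k)) (hYd : Measurable Yd)
    (hPdens : ∀ n i, Pi n i = (P n).withDensity fun ω => ENNReal.ofReal (X n ω i))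
    (hQdens : ∀ i, Qi i = Q.withDensity fun y => ENNReal.ofReal (Yd y i))
    (hconv : ∀ f : BoundedContinuousFunction (EuclideanSpace ℝ (Fin k)) ℝ,
      Tendsto (fun n => ∫ ω, f (X n ω) ∂(P n)) atTop (𝓝 (∫ y, f (Yd y) ∂Q))) :
    ∃ K : (n : ℕ) → Kernel 𝓨 (Ω n), (∀ n, IsMarkovKernel (K n)) ∧
      Tendsto (fun n => ⨆ i : Fin k, tvDist ((Qi i).bind (K n)) (Pi n i))
        atTop (𝓝 0) := by
  refine exists_seq_tendsto_zero (fun n (K : Kernel 𝓨 (Ω n)) => IsMarkovKernel K)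
    (fun n K => ⨆ i : Fin k, tvDist ((Qi i).bind K) (Pi n i))
    (fun n K => Real.iSup_nonneg fun i => Real.iSup_nonneg fun f => abs_nonneg _)
    (fun n => ⟨Kernel.const 𝓨 (P n), inferInstance⟩) fun δ hδ => ?_
  obtain ⟨R, hR⟩ := exists_radius_measureReal_lt Qi hYd (ε := δ / 8) (by positivity)
  obtain ⟨m, c, φ, hφ0, hφs, hφR, hφc⟩ :=
    exists_partition_of_unity (E := EuclideanSpace ℝ (Fin k)) (ε := δ / 16) (by positivity) R
  have htail : ∀ i, ∫ y, φ none (Yd y) ∂(Qi i) ≤ δ / 8 := fun i => by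
    refine le_trans ?_ (hR i).le
    have hmeas : MeasurableSet {y | R < ‖Yd y‖} := measurableSet_lt measurable_const hYd.norm
    rw [← integral_indicator_one hmeas]
    refine integral_mono_of_nonneg (Eventually.of_forall fun y => hφ0 _ _)
      ((integrable_const (1 : ℝ)).indicator hmeas) (Eventually.of_forall fun y => ?_)
    by_cases hy : R < ‖Yd y‖
    · rw [Set.indicator_of_mem (show y ∈ {y | R < ‖Yd y‖} from hy)]
      exact le_of_abs_le (abs_le_one_of_sum_eq_one (fun l => hφ0 l (Yd y)) (hφs (Yd y)) none)
    · change φ none (Yd y) ≤ _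
      rw [hφR _ (not_lt.1 hy)]
      exact Set.indicator_nonneg (fun _ _ => zero_le_one) _
  have herr : ∀ i, Tendsto (fun n => ∑ j, |max (c j i) 0| *
      |∫ ω, φ (some j) (X n ω) ∂(P n) - ∫ y, φ (some j) (Yd y) ∂Q|) atTop (𝓝 0) := fun i => by
    have := tendsto_finsetSum Finset.univ fun j _ =>
      (((hconv (φ (some j))).sub_const (∫ y, φ (some j) (Yd y) ∂Q)).abs.const_mul |max (c j i) 0|)
    simpa using this
  filter_upwards [eventually_all.2 fun i =>
    (herr i).eventually_lt_const (show (0 : ℝ) < δ / 8 by positivity)] with n hn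
  obtain ⟨K, hK, hKtv⟩ := exists_kernel_tvDist_le (P n) (Pi n) Q Qi (hX n) hYd (hPdens n) hQdens
    (by positivity) hφ0 hφs hφc
  refine ⟨K, hK, Real.iSup_le (fun i => (hKtv i).trans ?_) hδ.le⟩
  linarith [htail i, hn i]
end

section
/- Let k be a positive integer. For each n, let P_{n,1}, …, P_{n,k} be probability measures on a measurable space (Ω_n, F_n), all absolutely continuous with respect to a probability measure P_n, with densities X_{n,i} = dP_{n,i}/dP_n. Let Q_1, …, Q_k be probability measures on a measurable space (Y, A), all absolutely continuous with respect to a probability measure Q, with densities Y_i = dQ_i/dQ. Suppose the random vectors X_n = (X_{n,1}, …, X_{n,k}) converge in distribution under P_n to Y = (Y_1, …, Y_k) under Q. Then there exist probability kernels L_n from (Ω_n, F_n) to (Y, A) such that max_{1 ≤ i ≤ k} ‖P_{n,i} L_n − Q_i‖₁ → 0 as n → ∞. -/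
open MeasureTheory ProbabilityTheory Filter Topology

/-- Mixing probability densities `ψ j` with weights `w j` gives a Markov kernel, along which
test functions integrate to the mixture of their integrals. -/
theorem exists_mixture_kernel_s1 {Ω 𝓨 J : Type*} [MeasurableSpace Ω] [MeasurableSpace 𝓨]
    [Fintype J] (Q : Measure 𝓨) [IsProbabilityMeasure Q]
    {w : J → Ω → ℝ} (hw : ∀ j, Measurable (w j)) (hw0 : ∀ j ω, 0 ≤ w j ω)
    (hw1 : ∀ ω, ∑ j, w j ω = 1)
    {ψ : J → 𝓨 → ℝ} (hψ : ∀ j, Measurable (ψ j)) (hψ0 : ∀ j y, 0 ≤ ψ j y)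
    (hψi : ∀ j, Integrable (ψ j) Q) (hψ1 : ∀ j, ∫ y, ψ j y ∂Q = 1) :
    ∃ L : Kernel Ω 𝓨, IsMarkovKernel L ∧
      ∀ (μ : Measure Ω) [IsProbabilityMeasure μ] (f : 𝓨 → ℝ), Measurable f →
        (∀ y, |f y| ≤ 1) →
        ∫ y, f y ∂(μ.bind L) = ∑ j, (∫ ω, w j ω ∂μ) * ∫ y, f y * ψ j y ∂Q := by
  set g : Ω → 𝓨 → ENNReal := fun ω y => ENNReal.ofReal (∑ j, w j ω * ψ j y) with hg
  have hgm : Measurable (Function.uncurry g) := by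
    simp only [hg, Function.uncurry_def]
    fun_prop
  have hg0 : ∀ ω y, 0 ≤ ∑ j, w j ω * ψ j y := fun ω y =>
    Finset.sum_nonneg fun j _ => mul_nonneg (hw0 j ω) (hψ0 j y)
  have happ := Kernel.withDensity_apply (Kernel.const Ω Q) hgm
  have hmarkov : IsMarkovKernel (Kernel.withDensity (Kernel.const Ω Q) g) := by
    refine ⟨fun ω => ⟨?_⟩⟩
    rw [happ, withDensity_apply _ MeasurableSet.univ, Kernel.const_apply, Measure.restrict_univ,
      ← ofReal_integral_eq_lintegral_ofReal
        (integrable_finsetSum _ fun j _ => (hψi j).const_mul _) (ae_of_all _ (hg0 ω)),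
      integral_finsetSum _ fun j _ => (hψi j).const_mul _]
    simp [integral_const_mul, hψ1, hw1]
  refine ⟨_, hmarkov, fun μ _ f hf hf1 => ?_⟩
  have hbd : ∀ (ν : Measure 𝓨) [IsProbabilityMeasure ν], Integrable f ν := fun ν _ =>
    Integrable.of_bound hf.aestronglyMeasurable 1 (ae_of_all _ hf1)
  have hwi : ∀ j, Integrable (w j) μ := fun j =>
    Integrable.of_bound (hw j).aestronglyMeasurable 1 (ae_of_all _ fun ω => by
      rw [Real.norm_of_nonneg (hw0 j ω), ← hw1 ω]
      exact Finset.single_le_sum (fun j _ => hw0 j ω) (Finset.mem_univ j))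
  have hfψ : ∀ j, Integrable (fun y => f y * ψ j y) Q := fun j =>
    (hψi j).bdd_mul hf.aestronglyMeasurable (ae_of_all _ hf1)
  have hcomp := Kernel.integral_comp (κ := Kernel.const Unit μ)
    (η := Kernel.withDensity (Kernel.const Ω Q) g) (a := ()) (hbd _)
  rw [Kernel.comp_apply, Kernel.const_apply] at hcomp
  rw [hcomp]
  have hinner : ∀ ω, ∫ y, f y ∂(Kernel.withDensity (Kernel.const Ω Q) g ω)
      = ∑ j, w j ω * ∫ y, f y * ψ j y ∂Q := fun ω => by
    rw [happ, Kernel.const_apply, integral_withDensity_eq_integral_toReal_smul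
      (show Measurable (g ω) from hgm.comp measurable_prodMk_left)
      (ae_of_all _ fun y => ENNReal.ofReal_lt_top)]
    simp_rw [hg, ENNReal.toReal_ofReal (hg0 ω _), smul_eq_mul, ← integral_const_mul]
    rw [← integral_finsetSum _ fun j _ => (hfψ j).const_mul _]
    refine integral_congr_ae (ae_of_all _ fun y => ?_)
    simp only [Finset.sum_mul]
    exact Finset.sum_congr rfl fun j _ => by ring
  simp_rw [hinner]
  rw [integral_finsetSum _ fun j _ => (hwi j).mul_const _]
  simp_rw [integral_mul_const]

/-- The weight `φ` normalized to a probability density, or `1` if `φ` has zero integral. -/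
noncomputable def normalizedDensity {𝓨 : Type*} [MeasurableSpace 𝓨] (Q : Measure 𝓨)
    (φ : 𝓨 → ℝ) (y : 𝓨) : ℝ :=
  if ∫ z, φ z ∂Q = 0 then 1 else φ y / ∫ z, φ z ∂Q

section normalizedDensity

variable {𝓨 : Type*} [MeasurableSpace 𝓨] {Q : Measure 𝓨} {φ : 𝓨 → ℝ}

theorem measurable_normalizedDensity (hφ : Measurable φ) :
    Measurable (normalizedDensity Q φ) := by
  unfold normalizedDensity
  split_ifs <;> fun_prop

theorem normalizedDensity_nonneg (hφ : ∀ y, 0 ≤ φ y) (y : 𝓨) :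
    0 ≤ normalizedDensity Q φ y := by
  unfold normalizedDensity
  split_ifs
  · exact zero_le_one
  · exact div_nonneg (hφ y) (integral_nonneg hφ)

theorem integrable_normalizedDensity [IsFiniteMeasure Q] (hφ : Integrable φ Q) :
    Integrable (normalizedDensity Q φ) Q := by
  unfold normalizedDensity
  split_ifs
  · exact integrable_const _
  · exact hφ.div_const _

theorem integral_normalizedDensity [IsProbabilityMeasure Q] :
    ∫ y, normalizedDensity Q φ y ∂Q = 1 := by
  unfold normalizedDensity
  split_ifs with h
  · simp
  · rw [integral_div, div_self h]

/-- Replacing `φ * u` by its average against `φ` costs at most twice the oscillation of `u`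
around any constant. -/
theorem integral_abs_normalizedDensity_sub_le [IsFiniteMeasure Q] {u : 𝓨 → ℝ}
    (hφ0 : ∀ y, 0 ≤ φ y) (hφi : Integrable φ Q) (hφu : Integrable (fun y => φ y * u y) Q)
    (c : ℝ) :
    ∫ y, |(∫ z, φ z * u z ∂Q) * normalizedDensity Q φ y - φ y * u y| ∂Q
      ≤ 2 * ∫ y, φ y * |u y - c| ∂Q := by
  have hosc : Integrable (fun y => φ y * |u y - c|) Q := by
    refine (hφu.sub (hφi.mul_const c)).abs.congr (ae_of_all _ fun y => ?_)
    simp only [Pi.sub_apply, ← mul_sub, abs_mul, abs_of_nonneg (hφ0 y)]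
  have hosc0 : 0 ≤ ∫ y, φ y * |u y - c| ∂Q :=
    integral_nonneg fun y => mul_nonneg (hφ0 y) (abs_nonneg _)
  set m := ∫ z, φ z ∂Q with hm
  set q := ∫ z, φ z * u z ∂Q with hq
  by_cases h : m = 0
  · have hae : φ =ᵐ[Q] 0 := (integral_eq_zero_iff_of_nonneg hφ0 hφi).1 h
    have hq0 : q = 0 := integral_eq_zero_of_ae (by
      filter_upwards [hae] with y hy
      simp [hy])
    have : ∫ y, |q * normalizedDensity Q φ y - φ y * u y| ∂Q = 0 :=
      integral_eq_zero_of_ae (by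
        filter_upwards [hae] with y hy
        simp [hy, hq0])
    rw [this]
    positivity
  · have hm0 : 0 < m := lt_of_le_of_ne (integral_nonneg hφ0) (Ne.symm h)
    have hqm : |q - m * c| ≤ ∫ y, φ y * |u y - c| ∂Q := by
      rw [hq, hm, ← integral_mul_const, ← integral_sub hφu (hφi.mul_const c)]
      refine (abs_integral_le_integral_abs).trans_eq (integral_congr_ae (ae_of_all _ fun y => ?_))
      simp only [← mul_sub, abs_mul, abs_of_nonneg (hφ0 y)]
    calc ∫ y, |q * normalizedDensity Q φ y - φ y * u y| ∂Q
        ≤ ∫ y, (|q - m * c| / m * φ y + φ y * |u y - c|) ∂Q := by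
          refine integral_mono_of_nonneg (ae_of_all _ fun y => abs_nonneg _)
            ((hφi.const_mul _).add hosc) (ae_of_all _ fun y => ?_)
          have : q * normalizedDensity Q φ y - φ y * u y
              = (q - m * c) / m * φ y - φ y * (u y - c) := by
            rw [normalizedDensity, if_neg h, ← hm]
            field_simp
            ring
          simp only [this]
          refine (abs_sub _ _).trans_eq ?_
          rw [abs_mul, abs_div, abs_of_pos hm0, abs_mul, abs_of_nonneg (hφ0 y)]
      _ = |q - m * c| + ∫ y, φ y * |u y - c| ∂Q := by
          rw [integral_add (hφi.const_mul _) hosc, integral_const_mul, ← hm, div_mul_cancel₀ _ h]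
      _ ≤ _ := by linarith

end normalizedDensity

/-- A separable space carries a sequence of bump functions `p j` of diameter at most `δ`
whose partial sums increase to `1`, with remainder `T N` eventually vanishing at each point. -/
theorem exists_small_partition {E : Type*} [PseudoMetricSpace E]
    [TopologicalSpace.SeparableSpace E] [Nonempty E] {δ : ℝ} (hδ : 0 < δ) :
    ∃ (c : ℕ → E) (p T : ℕ → E → ℝ),
      (∀ j, Continuous (p j)) ∧ (∀ N, Continuous (T N)) ∧
      (∀ j x, 0 ≤ p j x) ∧ (∀ N x, 0 ≤ T N x) ∧
      (∀ N x, T N x + ∑ j : Fin N, p j x = 1) ∧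
      (∀ j x, p j x ≠ 0 → dist x (c j) ≤ δ) ∧
      ∀ x, ∀ᶠ N in atTop, T N x = 0 := by
  set c := TopologicalSpace.denseSeq E
  set b : ℕ → E → ℝ := fun j x => max 0 (min 1 (2 - 2 * dist x (c j) / δ)) with hb
  have hbc : ∀ j, Continuous (b j) := fun j => by
    simp only [hb]
    fun_prop
  have hb0 : ∀ j x, 0 ≤ b j x := fun j x => le_max_left _ _
  have hb1 : ∀ j x, 0 ≤ 1 - b j x := fun j x =>
    sub_nonneg.2 (max_le zero_le_one (min_le_left _ _))
  refine ⟨c, fun j x => (∏ i ∈ Finset.range j, (1 - b i x)) * b j x,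
    fun N x => ∏ i ∈ Finset.range N, (1 - b i x), fun j => by fun_prop, fun N => by fun_prop,
    fun j x => mul_nonneg (Finset.prod_nonneg fun i _ => hb1 i x) (hb0 j x),
    fun N x => Finset.prod_nonneg fun i _ => hb1 i x, fun N x => ?_, fun j x hx => ?_,
    fun x => ?_⟩
  · beta_reduce
    rw [Fin.sum_univ_eq_sum_range (fun j => (∏ i ∈ Finset.range j, (1 - b i x)) * b j x)]
    induction N with
    | zero => simp
    | succ N ih =>
      rw [Finset.prod_range_succ, Finset.sum_range_succ]
      linarith
  · by_contra! h
    refine right_ne_zero_of_mul hx (max_eq_left ((min_le_right _ _).trans ?_))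
    have : 1 < dist x (c j) / δ := (one_lt_div hδ).2 h
    rw [mul_div_assoc]
    linarith
  · obtain ⟨j, hj⟩ := (TopologicalSpace.denseRange_denseSeq E).exists_dist_lt x (half_pos hδ)
    filter_upwards [eventually_gt_atTop j] with N hN
    refine Finset.prod_eq_zero (Finset.mem_range.2 hN) (sub_eq_zero.2 (Eq.symm ?_))
    have h1 : 2 * dist x (c j) / δ ≤ 1 := (div_le_one hδ).2 (by linarith)
    have h2 : (1 : ℝ) ≤ 2 - 2 * dist x (c j) / δ := by linarith
    simp only [hb, min_eq_left h2, max_eq_right zero_le_one]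

/-- Finite partitions of unity, with all pieces but one boundedly supported, along which finitely
many integrable functions of the form `(Y i)⁺` oscillate little. -/
theorem exists_partition_oscillation_le {k : ℕ} {𝓨 : Type*} [MeasurableSpace 𝓨] {Q : Measure 𝓨}
    [IsProbabilityMeasure Q] {Y : 𝓨 → EuclideanSpace ℝ (Fin k)} (hY : Measurable Y)
    (hint : ∀ i, Integrable (fun y => max (Y y i) 0) Q) {ε : ℝ} (hε : 0 < ε) :
    ∃ (N : ℕ) (φ : Option (Fin N) → EuclideanSpace ℝ (Fin k) → ℝ),
      (∀ j, Continuous (φ j)) ∧ (∀ j x, 0 ≤ φ j x) ∧ (∀ x, ∑ j, φ j x = 1) ∧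
      (∀ j : Fin N, ∃ R, ∀ x, φ (some j) x ≠ 0 → ‖x‖ ≤ R) ∧
      ∃ c : Option (Fin N) → Fin k → ℝ,
        ∀ i, ∑ j, ∫ y, φ j (Y y) * |max (Y y i) 0 - c j i| ∂Q ≤ ε := by
  obtain ⟨c, p, T, hp, hT, hp0, hT0, hsum, hsupp, htail⟩ :=
    exists_small_partition (E := EuclideanSpace ℝ (Fin k)) (half_pos hε)
  have hT1 : ∀ N x, T N x ≤ 1 := fun N x => by
    have := Finset.sum_nonneg fun (j : Fin N) (_ : j ∈ Finset.univ) => hp0 j x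
    linarith [hsum N x]
  have htend : ∀ i, Tendsto (fun N => ∫ y, T N (Y y) * max (Y y i) 0 ∂Q) atTop (𝓝 0) := fun i => by
    suffices Tendsto (fun N => ∫ y, T N (Y y) * max (Y y i) 0 ∂Q) atTop (𝓝 (∫ _, (0 : ℝ) ∂Q)) by
      simpa only [integral_zero] using this
    refine tendsto_integral_of_dominated_convergence (fun y => max (Y y i) 0)
      (fun N => ((hT N).measurable.comp hY).aestronglyMeasurable.mul (hint i).1) (hint i)
      (fun N => ae_of_all _ fun y => ?_) (ae_of_all _ fun y => ?_)
    · rw [Real.norm_of_nonneg (mul_nonneg (hT0 _ _) (le_max_right _ _))]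
      exact mul_le_of_le_one_left (le_max_right _ _) (hT1 _ _)
    · refine tendsto_const_nhds.congr' ?_
      filter_upwards [htail (Y y)] with N hN
      rw [hN, zero_mul]
  obtain ⟨N, hN⟩ := (eventually_all.2 fun i =>
    (htend i).eventually_le_const (half_pos hε)).exists
  have hpi : ∀ j : Fin N, Integrable (fun y => p j (Y y)) Q := fun j =>
    Integrable.of_bound ((hp j).measurable.comp hY).aestronglyMeasurable 1 (ae_of_all _ fun y => by
      rw [Real.norm_of_nonneg (hp0 _ _)]
      have := Finset.single_le_sum (fun (j : Fin N) _ => hp0 j (Y y)) (Finset.mem_univ j)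
      linarith [hsum N (Y y), hT0 N (Y y)])
  refine ⟨N, fun j => j.elim (T N) fun j => p j, ?_, ?_, ?_, fun j => ⟨‖c j‖ + ε / 2, ?_⟩,
    fun j i => j.elim 0 fun j => max (c j i) 0, fun i => ?_⟩
  · rintro (_ | j)
    exacts [hT N, hp j]
  · rintro (_ | j)
    exacts [hT0 N, hp0 j]
  · intro x
    simpa [Fintype.sum_option] using hsum N x
  · intro x hx
    have := hsupp j x hx
    rw [dist_eq_norm] at this
    linarith [norm_le_norm_add_norm_sub' x (c j)]
  · simp only [Fintype.sum_option, Option.elim, sub_zero, abs_of_nonneg (le_max_right _ (0 : ℝ))]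
    have hloc : ∀ j : Fin N, ∫ y, p j (Y y) * |max (Y y i) 0 - max (c j i) 0| ∂Q
        ≤ ∫ y, p j (Y y) * (ε / 2) ∂Q := fun j => by
      refine integral_mono_of_nonneg (ae_of_all _ fun y => mul_nonneg (hp0 _ _) (abs_nonneg _))
        ((hpi j).mul_const _) (ae_of_all _ fun y => ?_)
      by_cases h : p j (Y y) = 0
      · simp [h]
      · refine mul_le_mul_of_nonneg_left ?_ (hp0 _ _)
        calc |max (Y y i) 0 - max (c j i) 0| ≤ |Y y i - c j i| := abs_max_sub_max_le_abs _ _ _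
          _ = ‖(Y y - c j) i‖ := rfl
          _ ≤ ‖Y y - c j‖ := PiLp.norm_apply_le _ _
          _ ≤ ε / 2 := by
            rw [← dist_eq_norm]
            exact hsupp j _ h
    have hlocsum : ∑ j : Fin N, ∫ y, p j (Y y) * (ε / 2) ∂Q ≤ ε / 2 := by
      simp_rw [integral_mul_const]
      rw [← Finset.sum_mul, ← integral_finsetSum _ fun j _ => hpi j]
      refine mul_le_of_le_one_left (half_pos hε).le ?_
      calc ∫ y, ∑ j : Fin N, p j (Y y) ∂Q ≤ ∫ _, (1 : ℝ) ∂Q :=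
            integral_mono (integrable_finsetSum _ fun j _ => hpi j) (integrable_const _)
              fun y => by linarith [hsum N (Y y), hT0 N (Y y)]
        _ = 1 := by simp
    linarith [hN i, Finset.sum_le_sum fun (j : Fin N) (_ : j ∈ Finset.univ) => hloc j]

theorem tvDist_nonneg {α : Type*} [MeasurableSpace α] (μ ν : Measure α) : 0 ≤ tvDist μ ν :=
  Real.iSup_nonneg fun _ => abs_nonneg _

theorem integral_withDensity_ofReal_eq {α : Type*} [MeasurableSpace α] {μ : Measure α}
    {u : α → ℝ} (hu : Measurable u) (g : α → ℝ) :
    ∫ x, g x ∂(μ.withDensity fun x => ENNReal.ofReal (u x)) = ∫ x, g x * max (u x) 0 ∂μ := by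
  rw [integral_withDensity_eq_integral_toReal_smul (by fun_prop)
    (ae_of_all _ fun x => ENNReal.ofReal_lt_top)]
  simp only [ENNReal.toReal_ofReal', smul_eq_mul, mul_comm]

theorem integrable_max_zero_of_withDensity {α : Type*} [MeasurableSpace α] {μ : Measure α}
    {u : α → ℝ} (hu : Measurable u)
    (h : IsFiniteMeasure (μ.withDensity fun x => ENNReal.ofReal (u x))) :
    Integrable (fun x => max (u x) 0) μ := by
  have hlt := measure_lt_top (μ.withDensity fun x => ENNReal.ofReal (u x)) Set.univ
  rw [withDensity_apply _ MeasurableSet.univ, Measure.restrict_univ] at hlt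
  simpa only [ENNReal.toReal_ofReal'] using
    integrable_toReal_of_lintegral_ne_top (by fun_prop) hlt.ne

/-- For a fixed accuracy `ε`, there are randomizations that eventually bring all the measures
within `ε` of their targets. -/
theorem exists_kernels_eventually_tvDist_le {k : ℕ} [Nonempty (Fin k)]
    {Ω : ℕ → Type*} [∀ n, MeasurableSpace (Ω n)]
    {𝓨 : Type*} [MeasurableSpace 𝓨]
    (P : (n : ℕ) → Measure (Ω n))
    (Pi : (n : ℕ) → Fin k → Measure (Ω n)) [∀ n i, IsProbabilityMeasure (Pi n i)]
    (Q : Measure 𝓨) [IsProbabilityMeasure Q]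
    (Qi : Fin k → Measure 𝓨) [∀ i, IsProbabilityMeasure (Qi i)]
    (X : (n : ℕ) → Ω n → EuclideanSpace ℝ (Fin k)) (hX : ∀ n, Measurable (X n))
    (Yd : 𝓨 → EuclideanSpace ℝ (Fin k)) (hYd : Measurable Yd)
    (hPdens : ∀ n i, Pi n i = (P n).withDensity fun ω => ENNReal.ofReal (X n ω i))
    (hQdens : ∀ i, Qi i = Q.withDensity fun y => ENNReal.ofReal (Yd y i))
    (hconv : ∀ f : BoundedContinuousFunction (EuclideanSpace ℝ (Fin k)) ℝ,
      Tendsto (fun n => ∫ ω, f (X n ω) ∂(P n)) atTop (𝓝 (∫ y, f (Yd y) ∂Q)))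
    {ε : ℝ} (hε : 0 < ε) :
    ∃ L : (n : ℕ) → Kernel (Ω n) 𝓨, (∀ n, IsMarkovKernel (L n)) ∧
      ∀ᶠ n in atTop, ⨆ i : Fin k, tvDist ((Pi n i).bind (L n)) (Qi i) ≤ ε := by
  have hXi : ∀ n i, Measurable fun ω => X n ω i := fun n i => by fun_prop
  have hYi : ∀ i, Measurable fun y => Yd y i := fun i => by fun_prop
  have hint : ∀ i, Integrable (fun y => max (Yd y i) 0) Q := fun i =>
    integrable_max_zero_of_withDensity (hYi i) (hQdens i ▸ inferInstance)
  have hQint : ∀ i (g : 𝓨 → ℝ), ∫ y, g y ∂(Qi i) = ∫ y, g y * max (Yd y i) 0 ∂Q := fun i g => by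
    rw [hQdens i, integral_withDensity_ofReal_eq (hYi i)]
  obtain ⟨N, φ, hφ, hφ0, hφ1, hsupp, c, hosc⟩ :=
    exists_partition_oscillation_le hYd hint (show 0 < ε / 4 by positivity)
  have hφle : ∀ j x, φ j x ≤ 1 := fun j x => by
    rw [← hφ1 x]
    exact Finset.single_le_sum (fun j _ => hφ0 j x) (Finset.mem_univ j)
  have hφnorm : ∀ j x, ‖φ j x‖ ≤ 1 := fun j x => by
    rw [Real.norm_of_nonneg (hφ0 j x)]
    exact hφle j x
  have hφint : ∀ (μ : Measure 𝓨) [IsFiniteMeasure μ] j, Integrable (fun y => φ j (Yd y)) μ :=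
    fun μ _ j => Integrable.of_bound ((hφ j).measurable.comp hYd).aestronglyMeasurable 1
      (ae_of_all _ fun _ => hφnorm j _)
  have hφint' : ∀ n i j, Integrable (fun ω => φ j (X n ω)) (Pi n i) := fun n i j =>
    Integrable.of_bound ((hφ j).measurable.comp (hX n)).aestronglyMeasurable 1
      (ae_of_all _ fun _ => hφnorm j _)
  have htend_some : ∀ i (j : Fin N), Tendsto (fun n => ∫ ω, φ (some j) (X n ω) ∂(Pi n i)) atTop
      (𝓝 (∫ y, φ (some j) (Yd y) ∂(Qi i))) := fun i j => by
    obtain ⟨R, hR⟩ := hsupp j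
    have hcont : Continuous fun x : EuclideanSpace ℝ (Fin k) => φ (some j) x * max (x i) 0 :=
      (hφ _).mul (by fun_prop)
    have hbound : ∀ x : EuclideanSpace ℝ (Fin k), ‖φ (some j) x * max (x i) 0‖ ≤ |R| := fun x => by
      by_cases h : φ (some j) x = 0
      · simp [h]
      · rw [norm_mul, ← one_mul |R|]
        refine mul_le_mul (hφnorm _ _) ?_ (norm_nonneg _) zero_le_one
        rw [Real.norm_of_nonneg (le_max_right _ _)]
        refine max_le ?_ (abs_nonneg _)
        exact (le_abs_self _).trans
          ((PiLp.norm_apply_le x i).trans ((hR x h).trans (le_abs_self R)))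
    rw [hQint]
    refine (hconv (BoundedContinuousFunction.ofNormedAddCommGroup _ hcont _ hbound)).congr
      fun n => ?_
    rw [hPdens n i, integral_withDensity_ofReal_eq (hXi n i)]
    rfl
  have htend : ∀ i j, Tendsto (fun n => ∫ ω, φ j (X n ω) ∂(Pi n i)) atTop
      (𝓝 (∫ y, φ j (Yd y) ∂(Qi i))) := by
    rintro i (_ | j)
    · have hnone : ∀ x, φ none x = 1 - ∑ j : Fin N, φ (some j) x := fun x => by
        rw [← hφ1 x, Fintype.sum_option]
        ring
      have hint_none : ∀ n, ∫ ω, φ none (X n ω) ∂(Pi n i)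
          = 1 - ∑ j : Fin N, ∫ ω, φ (some j) (X n ω) ∂(Pi n i) := fun n => by
        simp_rw [hnone]
        rw [integral_sub (integrable_const _) (integrable_finsetSum _ fun j _ => hφint' n i _),
          integral_finsetSum _ fun j _ => hφint' n i _]
        simp
      have hint_none' : ∫ y, φ none (Yd y) ∂(Qi i)
          = 1 - ∑ j : Fin N, ∫ y, φ (some j) (Yd y) ∂(Qi i) := by
        simp_rw [hnone]
        rw [integral_sub (integrable_const _) (integrable_finsetSum _ fun j _ => hφint _ _),
          integral_finsetSum _ fun j _ => hφint _ _]
        simp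
      simp_rw [hint_none, hint_none']
      exact tendsto_const_nhds.sub (tendsto_finsetSum _ fun j _ => htend_some i j)
    · exact htend_some i j
  set ψ : Option (Fin N) → 𝓨 → ℝ := fun j => normalizedDensity Q fun y => φ j (Yd y)
  have hψ : ∀ j, Measurable (ψ j) := fun j =>
    measurable_normalizedDensity ((hφ j).measurable.comp hYd)
  have hψ0 : ∀ j y, 0 ≤ ψ j y := fun j => normalizedDensity_nonneg fun y => hφ0 j _
  have hψi : ∀ j, Integrable (ψ j) Q := fun j => integrable_normalizedDensity (hφint _ j)
  have hψ1 : ∀ j, ∫ y, ψ j y ∂Q = 1 := fun j => integral_normalizedDensity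
  choose L hL hLint using fun n => exists_mixture_kernel_s1 Q (w := fun j ω => φ j (X n ω))
    (fun j => (hφ j).measurable.comp (hX n)) (fun j ω => hφ0 j _) (fun ω => hφ1 _) hψ hψ0 hψi hψ1
  refine ⟨L, hL, ?_⟩
  have hsmall : ∀ i, Tendsto (fun n => ∑ j, |∫ ω, φ j (X n ω) ∂(Pi n i) -
      ∫ y, φ j (Yd y) ∂(Qi i)|) atTop (𝓝 0) := fun i => by
    simpa using tendsto_finsetSum Finset.univ fun j _ =>
      ((htend i j).sub_const (∫ y, φ j (Yd y) ∂(Qi i))).abs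
  filter_upwards [eventually_all.2 fun i =>
    (hsmall i).eventually_le_const (half_pos hε)] with n hn
  refine ciSup_le fun i => ?_
  have : Nonempty { f : 𝓨 → ℝ // Measurable f ∧ ∀ x, |f x| ≤ 1 } :=
    ⟨⟨fun _ => 0, measurable_const, by simp⟩⟩
  refine ciSup_le fun ⟨f, hf, hf1⟩ => ?_
  have hφu : ∀ j, Integrable (fun y => φ j (Yd y) * max (Yd y i) 0) Q := fun j =>
    (hint i).bdd_mul ((hφ j).measurable.comp hYd).aestronglyMeasurable
      (ae_of_all _ fun _ => hφnorm j _)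
  have hfψ : ∀ j, Integrable (fun y => f y * ψ j y) Q := fun j =>
    (hψi j).bdd_mul hf.aestronglyMeasurable (ae_of_all _ hf1)
  have hfφu : ∀ j, Integrable (fun y => f y * (φ j (Yd y) * max (Yd y i) 0)) Q := fun j =>
    (hφu j).bdd_mul hf.aestronglyMeasurable (ae_of_all _ hf1)
  have hfψ1 : ∀ j, |∫ y, f y * ψ j y ∂Q| ≤ 1 := fun j => by
    rw [← hψ1 j]
    refine abs_integral_le_integral_abs.trans (integral_mono (hfψ j).abs (hψi j) fun y => ?_)
    simp only [abs_mul, abs_of_nonneg (hψ0 j y)]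
    exact mul_le_of_le_one_left (hψ0 j y) (hf1 y)
  have hsplit : ∫ y, f y ∂(Qi i) = ∑ j, ∫ y, f y * (φ j (Yd y) * max (Yd y i) 0) ∂Q := by
    rw [hQint, ← integral_finsetSum _ fun j _ => hfφu j]
    refine integral_congr_ae (ae_of_all _ fun y => ?_)
    simp only [← Finset.mul_sum, ← Finset.sum_mul, hφ1, one_mul]
  have hterm : ∀ j, |(∫ ω, φ j (X n ω) ∂(Pi n i)) * ∫ y, f y * ψ j y ∂Q -
      ∫ y, f y * (φ j (Yd y) * max (Yd y i) 0) ∂Q|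
      ≤ |∫ ω, φ j (X n ω) ∂(Pi n i) - ∫ y, φ j (Yd y) ∂(Qi i)| +
        2 * ∫ y, φ j (Yd y) * |max (Yd y i) 0 - c j i| ∂Q := fun j => by
    have havg : |(∫ y, φ j (Yd y) ∂(Qi i)) * ∫ y, f y * ψ j y ∂Q -
        ∫ y, f y * (φ j (Yd y) * max (Yd y i) 0) ∂Q|
        ≤ 2 * ∫ y, φ j (Yd y) * |max (Yd y i) 0 - c j i| ∂Q := by
      refine le_trans ?_ (integral_abs_normalizedDensity_sub_le (fun y => hφ0 j (Yd y))
        (hφint _ j) (hφu j) (c j i))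
      rw [hQint, ← integral_const_mul, ← integral_sub ((hfψ j).const_mul _) (hfφu j)]
      refine abs_integral_le_integral_abs.trans (integral_mono
        (((hfψ j).const_mul _).sub (hfφu j)).abs (((hψi j).const_mul _).sub (hφu j)).abs
        fun y => ?_)
      beta_reduce
      rw [mul_left_comm, ← mul_sub, abs_mul]
      exact mul_le_of_le_one_left (abs_nonneg _) (hf1 y)
    calc _ = |(∫ ω, φ j (X n ω) ∂(Pi n i) - ∫ y, φ j (Yd y) ∂(Qi i)) * ∫ y, f y * ψ j y ∂Q +
          ((∫ y, φ j (Yd y) ∂(Qi i)) * ∫ y, f y * ψ j y ∂Q -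
            ∫ y, f y * (φ j (Yd y) * max (Yd y i) 0) ∂Q)| := by
          congr 1
          ring
      _ ≤ _ := by
          refine (abs_add_le _ _).trans (add_le_add ?_ havg)
          rw [abs_mul]
          exact mul_le_of_le_one_right (abs_nonneg _) (hfψ1 j)
  simp only
  rw [hLint n (Pi n i) f hf hf1, hsplit, ← Finset.sum_sub_distrib]
  refine (Finset.abs_sum_le_sum_abs _ _).trans ((Finset.sum_le_sum fun j _ => hterm j).trans ?_)
  rw [Finset.sum_add_distrib, ← Finset.mul_sum]
  linarith [hn i, hosc i]

/-- **Lemma 1 (second assertion, `𝒫ₙ ⊃ 𝒬` direction).**  If the vectors of densities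
`Xₙ = (dPₙ,ᵢ/dPₙ)ᵢ` converge in distribution (under `Pₙ`) to the vector of densities
`Y = (dQᵢ/dQ)ᵢ` (under `Q`), then there are Markov kernels `Lₙ` from `Ωₙ` to `𝓨` with
`maxᵢ ‖Pₙ,ᵢ Lₙ − Qᵢ‖₁ → 0`. -/
theorem statement1 {k : ℕ} (hk : 0 < k)
    {Ω : ℕ → Type*} [∀ n, MeasurableSpace (Ω n)]
    {𝓨 : Type*} [MeasurableSpace 𝓨]
    (P : (n : ℕ) → Measure (Ω n)) [∀ n, IsProbabilityMeasure (P n)]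
    (Pi : (n : ℕ) → Fin k → Measure (Ω n)) [∀ n i, IsProbabilityMeasure (Pi n i)]
    (Q : Measure 𝓨) [IsProbabilityMeasure Q]
    (Qi : Fin k → Measure 𝓨) [∀ i, IsProbabilityMeasure (Qi i)]
    (X : (n : ℕ) → Ω n → EuclideanSpace ℝ (Fin k)) (hX : ∀ n, Measurable (X n))
    (Yd : 𝓨 → EuclideanSpace ℝ (Fin k)) (hYd : Measurable Yd)
    (hPdens : ∀ n i, Pi n i = (P n).withDensity fun ω => ENNReal.ofReal (X n ω i))
    (hQdens : ∀ i, Qi i = Q.withDensity fun y => ENNReal.ofReal (Yd y i))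
    (hconv : ∀ f : BoundedContinuousFunction (EuclideanSpace ℝ (Fin k)) ℝ,
      Tendsto (fun n => ∫ ω, f (X n ω) ∂(P n)) atTop (𝓝 (∫ y, f (Yd y) ∂Q))) :
    ∃ L : (n : ℕ) → Kernel (Ω n) 𝓨, (∀ n, IsMarkovKernel (L n)) ∧
      Tendsto (fun n => ⨆ i : Fin k, tvDist ((Pi n i).bind (L n)) (Qi i))
        atTop (𝓝 0) := by
  have : Nonempty (Fin k) := ⟨⟨0, hk⟩⟩
  have key := fun {ε : ℝ} (hε : 0 < ε) => exists_kernels_eventually_tvDist_le P Pi Q Qi X hX Yd hYd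
    hPdens hQdens hconv hε
  set d : (n : ℕ) → Kernel (Ω n) 𝓨 → ℝ := fun n L =>
    ⨆ i : Fin k, tvDist ((Pi n i).bind L) (Qi i)
  have hd0 : ∀ n L, 0 ≤ d n L := fun n L => Real.iSup_nonneg fun i => tvDist_nonneg _ _
  set S : ℕ → Set ℝ := fun n => d n '' {L | IsMarkovKernel L}
  have hbdd : ∀ n, BddBelow (S n) := fun n => ⟨0, by
    rintro _ ⟨L, -, rfl⟩
    exact hd0 n L⟩
  have hne : ∀ n, (S n).Nonempty := fun n => by
    obtain ⟨L, hL, -⟩ := key one_pos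
    exact ⟨_, L n, hL n, rfl⟩
  have hnear : ∀ n : ℕ, ∃ L : Kernel (Ω n) 𝓨, IsMarkovKernel L ∧
      d n L < sInf (S n) + 1 / ((n : ℝ) + 1) := fun n => by
    obtain ⟨_, ⟨L, hL, rfl⟩, hlt⟩ :=
      exists_lt_of_csInf_lt (hne n) (lt_add_of_pos_right _ (Nat.one_div_pos_of_nat (n := n)))
    exact ⟨L, hL, hlt⟩
  choose L hL hlt using hnear
  refine ⟨L, hL, ?_⟩
  have hinf : Tendsto (fun n => sInf (S n)) atTop (𝓝 0) := by
    refine tendsto_order.2 ⟨fun a ha => Eventually.of_forall fun n => ha.trans_le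
      (Real.sInf_nonneg fun r ⟨L, _, hr⟩ => hr ▸ hd0 n L), fun a ha => ?_⟩
    obtain ⟨L', hL', hev⟩ := key (half_pos ha)
    filter_upwards [hev] with n hn
    exact ((csInf_le (hbdd n) ⟨L' n, hL' n, rfl⟩).trans hn).trans_lt (half_lt_self ha)
  refine squeeze_zero (fun n => hd0 n (L n)) (fun n => (hlt n).le) ?_
  simpa using hinf.add tendsto_one_div_add_atTop_nhds_zero_nat
end

section
/- Let P be a probability measure on (Ω, F), Q a probability measure on (Y, A), 0 < ε < 1, X : Ω → ℝ^k and Y : Y → ℝ^k measurable, B_0, …, B_m a Borel partition of ℝ^k, F_α = {X ∈ B_α}, A_α = {Y ∈ B_α}, and suppose P(F_α) ≥ (1 − ε)Q(A_α) for all α. Let μ be the probability measure on F with ε μ(F) = Σ_α (P(F_α) − (1 − ε)Q(A_α)) P(F | F_α), and define the probability kernel K from (Y, A) to (Ω, F) by K_y(·) = ε μ(·) + (1 − ε) Σ_α 1{y ∈ A_α} P(· | F_α) (kernel values taken to be μ on the Q-null complement where no well-defined term applies). Define the probability measure M on the product sigma-field A ⊗ F by M = ε (Q ⊗ μ) + (1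 − ε) Σ_α Q(A_α) · ( Q(· | A_α) ⊗ P(· | F_α) ). Then for every bounded product-measurable g : Y × Ω → ℝ, ∫∫ g(y, ω) M(dy, dω) = ∫ ( ∫ g(y, ω) K_y(dω) ) Q(dy); in particular, M has marginal Q on Y and marginal P on Ω. -/
open MeasureTheory ProbabilityTheory Filter Topology
open scoped ENNReal NNReal Classical

/-- Multiplying the conditional measure by the mass of the event recovers the restriction. -/
lemma measure_smul_cond {Ω : Type*} [MeasurableSpace Ω] (P : Measure Ω) [IsFiniteMeasure P]
    (s : Set Ω) : P s • P[|s] = P.restrict s := by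
  by_cases h : P s = 0
  · rw [h, zero_smul, Measure.restrict_eq_zero.2 h]
  · rw [ProbabilityTheory.cond, smul_smul, ENNReal.mul_inv_cancel h (measure_ne_top P s), one_smul]

/-- Restrictions to the cells of a countable measurable partition add up to the measure. -/
lemma sum_restrict_of_partition {Ω ι : Type*} [MeasurableSpace Ω] [Countable ι] (P : Measure Ω)
    {s : ι → Set Ω} (hs : ∀ i, MeasurableSet (s i)) (hd : Pairwise (Function.onFun Disjoint s))
    (hc : ⋃ i, s i = Set.univ) : (Measure.sum fun i => P.restrict (s i)) = P := by
  rw [← Measure.restrict_iUnion hd hs, hc, Measure.restrict_univ]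

/-- `P(· | s)` has total mass one unless `s` is null, so weighting it by a `q` that vanishes
in that case gives total mass `q`. -/
lemma measure_mul_cond_univ {Ω : Type*} [MeasurableSpace Ω] (P : Measure Ω) [IsFiniteMeasure P]
    {s : Set Ω} {q : ℝ≥0∞} (h : P s = 0 → q = 0) : q * P[|s] Set.univ = q := by
  by_cases hs : P s = 0
  · rw [h hs, zero_mul]
  · have := cond_isProbabilityMeasure hs
    rw [measure_univ, mul_one]

/-- The remainder `∑ (P(F_α) − c Q_α) P(· | F_α)` completes `c ∑ Q_α P(· | F_α)` to `P`. -/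
lemma sum_sub_smul_cond_add {Ω ι : Type*} [MeasurableSpace Ω] [Fintype ι] (P : Measure Ω)
    [IsFiniteMeasure P] {F : ι → Set Ω} (hF : ∀ i, MeasurableSet (F i))
    (hd : Pairwise (Function.onFun Disjoint F)) (hc : ⋃ i, F i = Set.univ)
    {c : ℝ≥0∞} {q : ι → ℝ≥0∞} (hq : ∀ i, c * q i ≤ P (F i)) :
    (Measure.sum fun i => (P (F i) - c * q i) • P[|F i]) +
      c • (Measure.sum fun i => q i • P[|F i]) = P := by
  conv_rhs => rw [← sum_restrict_of_partition P hF hd hc]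
  simp_rw [Measure.sum_fintype, Finset.smul_sum, ← Finset.sum_add_distrib]
  refine Finset.sum_congr rfl fun i _ => ?_
  rw [smul_smul, ← add_smul, tsub_add_cancel_of_le (hq i), measure_smul_cond]

/-- **The kernel/joint-measure construction of Lemma 2.**  With
`F_α = {X ∈ B_α}`, `A_α = {Y ∈ B_α}`, `μ` defined by
`ε μ(F) = ∑_α (P(F_α) − (1−ε) Q(A_α)) P(F | F_α)`, the kernel
`K_y = ε μ + (1−ε) ∑_α 1{y ∈ A_α} P(· | F_α)` and the joint measure
`M = ε (Q ⊗ μ) + (1−ε) ∑_α Q(A_α) (Q(·|A_α) ⊗ P(·|F_α))`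
satisfy `∬ g dM = ∫ (∫ g(y,ω) K_y(dω)) Q(dy)` for every bounded product-measurable `g`;
in particular `M` has marginals `Q` and `P`. -/
theorem statement4 {k m : ℕ}
    {Ω 𝓨 : Type*} [MeasurableSpace Ω] [MeasurableSpace 𝓨]
    (P : Measure Ω) [IsProbabilityMeasure P]
    (Q : Measure 𝓨) [IsProbabilityMeasure Q]
    {ε : ℝ} (hε0 : 0 < ε) (hε1 : ε < 1)
    (X : Ω → EuclideanSpace ℝ (Fin k)) (hX : Measurable X)
    (Yd : 𝓨 → EuclideanSpace ℝ (Fin k)) (hYd : Measurable Yd)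
    (B : Fin (m + 1) → Set (EuclideanSpace ℝ (Fin k)))
    (hBmeas : ∀ α, MeasurableSet (B α))
    (hBdisj : Pairwise (Function.onFun Disjoint B))
    (hBcover : ⋃ α, B α = Set.univ)
    (hmass : ∀ α, ENNReal.ofReal (1 - ε) * Q (Yd ⁻¹' B α) ≤ P (X ⁻¹' B α))
    -- the measure `μ` with `ε μ(F) = ∑_α (P(F_α) − (1−ε) Q(A_α)) P(F | F_α)`
    (μ : Measure Ω)
    (hμ : μ = (ENNReal.ofReal ε)⁻¹ •
        Measure.sum fun α : Fin (m + 1) =>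
          (P (X ⁻¹' B α) - ENNReal.ofReal (1 - ε) * Q (Yd ⁻¹' B α)) • P[|X ⁻¹' B α])
    -- the probability kernel `K_y = ε μ + (1−ε) ∑_α 1{y ∈ A_α} P(· | F_α)`
    (K : 𝓨 → Measure Ω)
    (hK : K = fun y => ENNReal.ofReal ε • μ +
        ENNReal.ofReal (1 - ε) •
          Measure.sum fun α : Fin (m + 1) =>
            (if y ∈ Yd ⁻¹' B α then (1 : ℝ≥0∞) else 0) • P[|X ⁻¹' B α])
    -- the joint measure `M = ε (Q ⊗ μ) + (1−ε) ∑_α Q(A_α) (Q(·|A_α) ⊗ P(·|F_α))`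
    (M : Measure (𝓨 × Ω))
    (hM : M = ENNReal.ofReal ε • Q.prod μ +
        ENNReal.ofReal (1 - ε) •
          Measure.sum fun α : Fin (m + 1) =>
            Q (Yd ⁻¹' B α) • (Q[|Yd ⁻¹' B α]).prod (P[|X ⁻¹' B α])) :
    (∀ g : 𝓨 × Ω → ℝ, Measurable g → (∃ C : ℝ, ∀ p, |g p| ≤ C) →
        ∫ p, g p ∂M = ∫ y, ∫ ω, g (y, ω) ∂(K y) ∂Q) ∧
      M.map Prod.fst = Q ∧ M.map Prod.snd = P := by
  set c := ENNReal.ofReal (1 - ε) with hc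
  set e := ENNReal.ofReal ε with he
  set A : Fin (m + 1) → Set 𝓨 := fun α => Yd ⁻¹' B α
  set F : Fin (m + 1) → Set Ω := fun α => X ⁻¹' B α
  have hAm : ∀ α, MeasurableSet (A α) := fun α => hYd (hBmeas α)
  have hFm : ∀ α, MeasurableSet (F α) := fun α => hX (hBmeas α)
  have hAd : Pairwise (Function.onFun Disjoint A) := fun i j h => (hBdisj h).preimage Yd
  have hFd : Pairwise (Function.onFun Disjoint F) := fun i j h => (hBdisj h).preimage X
  have hAc : ⋃ α, A α = Set.univ := by rw [← Set.preimage_iUnion, hBcover, Set.preimage_univ]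
  have hFc : ⋃ α, F α = Set.univ := by rw [← Set.preimage_iUnion, hBcover, Set.preimage_univ]
  have he0 : e ≠ 0 := by simpa [he] using hε0
  have hetop : e ≠ ⊤ := ENNReal.ofReal_ne_top
  have hc0 : c ≠ 0 := by simpa [hc] using hε1
  have hnull : ∀ α, P (F α) = 0 → Q (A α) = 0 := fun α h => by
    have := hmass α
    rw [h, nonpos_iff_eq_zero] at this
    exact (mul_eq_zero.1 this).resolve_left hc0
  have heμ : e • μ = Measure.sum fun α => (P (F α) - c * Q (A α)) • P[|F α] := by
    rw [hμ, smul_smul, ENNReal.mul_inv_cancel he0 hetop, one_smul]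
  have hPdecomp : e • μ + c • (Measure.sum fun α => Q (A α) • P[|F α]) = P := by
    rw [heμ]; exact sum_sub_smul_cond_add P hFm hFd hFc hmass
  have hμuniv : e * μ Set.univ + c = 1 := by
    have h := congrArg (fun ν : Measure Ω => ν Set.univ) hPdecomp
    have hQ : ∑ α, Q (A α) = 1 := by
      have := congrArg (fun ν : Measure 𝓨 => ν Set.univ) (sum_restrict_of_partition Q hAm hAd hAc)
      simpa [Measure.sum_fintype] using this
    simpa [Measure.sum_fintype, measure_mul_cond_univ P (hnull _), hQ] using h
  have : IsFiniteMeasure μ := by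
    refine ⟨lt_top_iff_ne_top.2 fun h => ?_⟩
    rw [h, ENNReal.mul_top he0] at hμuniv
    simp at hμuniv
  have hM' : M = e • Q.prod μ + c • ∑ α, (Q.restrict (A α)).prod (P[|F α]) := by
    rw [hM, Measure.sum_fintype]
    congr 3 with α : 1
    rw [← measure_smul_cond Q, Measure.prod_smul_left]
  refine ⟨fun g hg ⟨C, hC⟩ => ?_, ?_, ?_⟩
  · have hint : ∀ (ν : Measure (𝓨 × Ω)) [IsFiniteMeasure ν], Integrable g ν := fun ν _ =>
      Integrable.of_bound hg.aestronglyMeasurable C (ae_of_all _ hC)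
    have hint' : ∀ y (ν : Measure Ω) [IsFiniteMeasure ν], Integrable (fun ω => g (y, ω)) ν :=
      fun y ν _ => Integrable.of_bound (hg.comp measurable_prodMk_left).aestronglyMeasurable C
        (ae_of_all _ fun ω => hC (y, ω))
    have hinner : ∀ y, ∫ ω, g (y, ω) ∂(K y) = e.toReal * ∫ ω, g (y, ω) ∂μ +
        c.toReal * ∑ α, (A α).indicator (fun y => ∫ ω, g (y, ω) ∂P[|F α]) y := by
      intro y
      have hterm : ∀ α, IsFiniteMeasure ((if y ∈ A α then (1 : ℝ≥0∞) else 0) • P[|F α]) := by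
        intro α
        split_ifs <;> simp <;> infer_instance
      simp only [hK]
      rw [Measure.sum_fintype, integral_add_measure, integral_smul_measure,
        integral_smul_measure, integral_finsetSum_measure]
      · simp only [smul_eq_mul]
        congr 2
        refine Finset.sum_congr rfl fun α _ => ?_
        change ∫ ω, g (y, ω) ∂((if y ∈ A α then (1 : ℝ≥0∞) else 0) • P[|F α]) = _
        by_cases h : y ∈ A α <;> simp [h]
      · exact fun α _ => hint' y _
      · exact (hint' y μ).smul_measure hetop
      · exact (hint' y _).smul_measure ENNReal.ofReal_ne_top
    simp_rw [hinner]
    have hα : ∀ α, Integrable (fun y => ∫ ω, g (y, ω) ∂P[|F α]) Q :=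
      fun α => (hint (Q.prod P[|F α])).integral_prod_left
    rw [hM', integral_add_measure ((hint _).smul_measure hetop)
        ((hint _).smul_measure ENNReal.ofReal_ne_top), integral_smul_measure,
      integral_smul_measure, integral_finsetSum_measure fun α _ => hint _, integral_add,
      integral_const_mul, integral_const_mul, integral_finsetSum, integral_prod g (hint _)]
    · simp only [smul_eq_mul]
      congr 2
      refine Finset.sum_congr rfl fun α _ => ?_
      rw [integral_prod g (hint _), integral_indicator (hAm α)]
    · exact fun α _ => (hα α).indicator (hAm α)
    · exact (hint (Q.prod μ)).integral_prod_left.const_mul _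
    · exact (integrable_finsetSum _ fun α _ => (hα α).indicator (hAm α)).const_mul _
  · have hcell : ∀ α, P[|F α] Set.univ • Q.restrict (A α) = Q.restrict (A α) := fun α => by
      rw [← measure_smul_cond Q, smul_smul, mul_comm, measure_mul_cond_univ P (hnull α)]
    rw [hM', Measure.map_add _ _ measurable_fst, Measure.map_smul, Measure.map_smul,
      ← Measure.sum_fintype, Measure.map_sum measurable_fst.aemeasurable, Measure.map_fst_prod]
    simp_rw [Measure.map_fst_prod, hcell]
    rw [sum_restrict_of_partition Q hAm hAd hAc, smul_smul, ← add_smul, hμuniv, one_smul]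
  · rw [hM, Measure.map_add _ _ measurable_snd, Measure.map_smul, Measure.map_smul,
      Measure.map_sum measurable_snd.aemeasurable, Measure.map_snd_prod, measure_univ, one_smul]
    conv_rhs => rw [← hPdecomp]
    congr 3 with α : 1
    rw [← Measure.prod_smul_left, measure_smul_cond, Measure.map_snd_prod,
      Measure.restrict_apply_univ]
end

section
/- Local asymptotic minimax theorem. Let T be a measurable space serving as both parameter set and action set, let L : T × T → [0, ∞] be a loss function with z ↦ L_t(z) measurable for each t ∈ T, let {Q_t : t ∈ T} be probability measures on (Y, A), and for each n let {P_{n,t} : t ∈ T_n} be probability measures on (Ω_n, F_n), where the sets T_n ⊆ T satisfy liminf T_n = T (every t ∈ T belongs to T_n for all sufficiently large n). Define, for a probability kernel ρ from (Y, A) to T, a finite set S ⊆ T, and M > 0: R(ρ, S, M) = max_{t ∈ S} ∫∫ (M ∧ L_t(z)) ρ_y(dz) Q_t(dy), and set R = inf_ρ sup_{t ∈ T} ∫∫ L_t(z) ρ_y(dz) Q_t(dy). Assume: (a) for each finite S ⊆ T there exist probability kernels K_n from (Y, A) to (Ω_n, F_n) with max_{t ∈ S} ‖Q_t K_n − P_{n,t}‖₁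 → 0; (b) the minimax equality R = sup_{S finite, M > 0} inf_ρ R(ρ, S, M) holds. Then for each R' < R there exist a finite M > 0 and a finite subset S of T such that, for all sufficiently large n, inf_τ max_{t ∈ S} ∫∫ (M ∧ L_t(z)) τ_ω(dz) P_{n,t}(dω) > R', where the infimum runs over all probability kernels τ from (Ω_n, F_n) to T. -/
open MeasureTheory ProbabilityTheory Filter Topology
open scoped ENNReal NNReal

/-- Evaluating at a test function bounds the total variation distance from below. -/
lemma abs_integral_sub_le_tvDist {α : Type*} [MeasurableSpace α] (μ ν : Measure α)
    [IsProbabilityMeasure μ] [IsProbabilityMeasure ν] {f : α → ℝ} (hf : Measurable f)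
    (hf1 : ∀ x, |f x| ≤ 1) :
    |∫ x, f x ∂μ - ∫ x, f x ∂ν| ≤ tvDist μ ν := by
  have hbound : ∀ (ρ : Measure α) [IsProbabilityMeasure ρ] (g : α → ℝ), (∀ x, |g x| ≤ 1) →
      |∫ x, g x ∂ρ| ≤ 1 := by
    intro ρ _ g hg
    simpa using norm_integral_le_of_norm_le_const (μ := ρ) (f := g) (C := 1)
      (Eventually.of_forall hg)
  have hbdd : BddAbove (Set.range fun g : { g : α → ℝ // Measurable g ∧ ∀ x, |g x| ≤ 1 } =>
      |∫ x, g.1 x ∂μ - ∫ x, g.1 x ∂ν|) := by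
    refine ⟨1 + 1, ?_⟩
    rintro _ ⟨g, rfl⟩
    exact (abs_sub _ _).trans
      (add_le_add (hbound μ g.1 g.2.2) (hbound ν g.1 g.2.2))
  exact le_ciSup hbdd ⟨f, hf, hf1⟩

/-- Integrals of a function with values in `[0, M]` differ by at most `M` times the total
variation distance. -/
lemma lintegral_le_add_mul_tvDist {α : Type*} [MeasurableSpace α] (μ ν : Measure α)
    [IsProbabilityMeasure μ] [IsProbabilityMeasure ν] {g : α → ℝ≥0∞} (hg : Measurable g)
    {M : ℝ≥0∞} (hM0 : M ≠ 0) (hM : M ≠ ⊤) (hgM : ∀ x, g x ≤ M) :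
    ∫⁻ x, g x ∂μ ≤ ∫⁻ x, g x ∂ν + M * ENNReal.ofReal (tvDist μ ν) := by
  let h : α → ℝ≥0∞ := fun x => M⁻¹ * g x
  have hhm : Measurable h := hg.const_mul _
  have hh1 : ∀ x, h x ≤ 1 := fun x =>
    (mul_le_mul_right (hgM x) M⁻¹).trans (ENNReal.inv_mul_cancel hM0 hM).le
  have hfin : ∀ x, h x < ⊤ := fun x => (hh1 x).trans_lt ENNReal.one_lt_top
  have hlint : ∀ (ρ : Measure α) [IsProbabilityMeasure ρ], ∫⁻ x, h x ∂ρ ≠ ⊤ := fun ρ _ =>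
    ((lintegral_mono hh1).trans_lt (by simp)).ne
  have hgh : ∀ ρ : Measure α, ∫⁻ x, g x ∂ρ = M * ∫⁻ x, h x ∂ρ := by
    intro ρ
    rw [lintegral_const_mul _ hg, ← mul_assoc, ENNReal.mul_inv_cancel hM0 hM, one_mul]
  have htv := abs_integral_sub_le_tvDist μ ν hhm.ennreal_toReal (fun x => by
    rw [abs_of_nonneg ENNReal.toReal_nonneg]
    exact ENNReal.toReal_mono ENNReal.one_ne_top (hh1 x))
  rw [integral_toReal hhm.aemeasurable (Eventually.of_forall hfin),
    integral_toReal hhm.aemeasurable (Eventually.of_forall hfin)] at htv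
  have key : ∫⁻ x, h x ∂μ ≤ ∫⁻ x, h x ∂ν + ENNReal.ofReal (tvDist μ ν) := by
    rw [← ENNReal.ofReal_toReal (hlint μ), ← ENNReal.ofReal_toReal (hlint ν),
      ← ENNReal.ofReal_add ENNReal.toReal_nonneg ((abs_nonneg _).trans htv)]
    exact ENNReal.ofReal_le_ofReal (by linarith [(abs_le.1 htv).2])
  rw [hgh μ, hgh ν, ← mul_add]
  gcongr

/-- A member of a finite family of reals is at most its supremum over the index set. -/
lemma Finset.le_real_biSup {ι : Type*} (S : Finset ι) (f : ι → ℝ) {i : ι} (hi : i ∈ S) :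
    f i ≤ ⨆ j ∈ S, f j := by
  have hbdd : BddAbove (Set.range fun j => ⨆ _ : j ∈ S, f j) := by
    obtain ⟨B, hB⟩ := (S.finite_toSet.image f).bddAbove
    refine ⟨max B 0, ?_⟩
    rintro _ ⟨j, rfl⟩
    by_cases hj : j ∈ S
    · simpa [hj] using Or.inl (hB ⟨j, hj, rfl⟩)
    · simp [hj]
  refine le_trans ?_ (le_ciSup hbdd i)
  simp [hi]

/-- **Local asymptotic minimax theorem (Theorem 5).**  Suppose `𝒫ₙ ⊂_w 𝒬`
(for each finite `S ⊆ T` there are Markov kernels `Kₙ` with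
`max_{t ∈ S} ‖Q_t Kₙ − P_{n,t}‖₁ → 0`) and the minimax equality holds for the limit
experiment `𝒬`.  Then for each `R' < R` there are a finite `M` and a finite `S ⊆ T`
such that `inf_τ max_{t ∈ S} ∬ (M ∧ L_t) dτ dP_{n,t} > R'` for all `n` large enough. -/
theorem statement9 {T 𝓨 : Type*} [MeasurableSpace T] [MeasurableSpace 𝓨]
    {Ω : ℕ → Type*} [∀ n, MeasurableSpace (Ω n)]
    (L : T → T → ℝ≥0∞) (hL : ∀ t, Measurable (L t))
    (Q : T → Measure 𝓨) [∀ t, IsProbabilityMeasure (Q t)]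
    (Tn : ℕ → Set T) (hTn : ∀ t : T, ∀ᶠ n in atTop, t ∈ Tn n)
    (P : (n : ℕ) → T → Measure (Ω n))
    (hP : ∀ n, ∀ t ∈ Tn n, IsProbabilityMeasure (P n t))
    -- the minimax risk for the limit experiment 𝒬
    (R : ℝ≥0∞)
    (hR : R = ⨅ ρ : { ρ : Kernel 𝓨 T // IsMarkovKernel ρ },
        ⨆ t : T, ∫⁻ y, ∫⁻ z, L t z ∂(ρ.1 y) ∂(Q t))
    -- (a) 𝒫ₙ ⊂_w 𝒬
    (ha : ∀ S : Finset T, ∃ K : (n : ℕ) → Kernel 𝓨 (Ω n),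
        (∀ n, IsMarkovKernel (K n)) ∧
        Tendsto (fun n => ⨆ t ∈ S, tvDist ((Q t).bind (K n)) (P n t)) atTop (𝓝 0))
    -- (b) the minimax equality ⟨4⟩ for the limit experiment 𝒬
    (hb : R = ⨆ (S : Finset T) (M : ℝ≥0∞) (_ : 0 < M ∧ M ≠ ⊤),
        ⨅ ρ : { ρ : Kernel 𝓨 T // IsMarkovKernel ρ },
          ⨆ t ∈ S, ∫⁻ y, ∫⁻ z, min M (L t z) ∂(ρ.1 y) ∂(Q t)) :
    ∀ R' : ℝ≥0∞, R' < R →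
      ∃ (M : ℝ≥0∞) (S : Finset T), 0 < M ∧ M ≠ ⊤ ∧
        ∀ᶠ n in atTop,
          R' < ⨅ τ : { τ : Kernel (Ω n) T // IsMarkovKernel τ },
            ⨆ t ∈ S, ∫⁻ ω, ∫⁻ z, min M (L t z) ∂(τ.1 ω) ∂(P n t) := by
  intro R' hR'
  rw [hb] at hR'
  obtain ⟨S, hS⟩ := lt_iSup_iff.1 hR'
  obtain ⟨M, hM⟩ := lt_iSup_iff.1 hS
  obtain ⟨⟨hM0, hMtop⟩, hlt⟩ := lt_iSup_iff.1 hM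
  obtain ⟨δ, hδ, hδlt⟩ := ENNReal.lt_iff_exists_add_pos_lt.1 hlt
  obtain ⟨K, hK, htend⟩ := ha S
  refine ⟨M, S, hM0, hMtop, ?_⟩
  have hsmall : ∀ᶠ n in atTop,
      M * ENNReal.ofReal (⨆ t ∈ S, tvDist ((Q t).bind (K n)) (P n t)) < (δ / 2 : ℝ≥0) := by
    have h := ENNReal.Tendsto.const_mul (a := M) (ENNReal.tendsto_ofReal htend) (Or.inr hMtop)
    rw [ENNReal.ofReal_zero, mul_zero] at h
    exact h.eventually_lt_const (by simpa using hδ.ne')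
  have hprob : ∀ᶠ n in atTop, ∀ t ∈ S, t ∈ Tn n :=
    (Filter.eventually_all_finset S).2 fun t _ => hTn t
  filter_upwards [hsmall, hprob] with n hn hPn
  have hR'top : R' ≠ ⊤ := hlt.ne_top
  refine lt_of_lt_of_le (ENNReal.lt_add_right hR'top
    (b := (δ / 2 : ℝ≥0)) (by simpa using hδ.ne')) (le_iInf fun τ => ?_)
  obtain ⟨τ, hτ⟩ := τ
  have := hK n
  have hcomp : ∀ t ∈ S, ∫⁻ y, ∫⁻ z, min M (L t z) ∂((τ ∘ₖ K n) y) ∂(Q t) ≤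
      (⨆ t ∈ S, ∫⁻ ω, ∫⁻ z, min M (L t z) ∂(τ ω) ∂(P n t)) + (δ / 2 : ℝ≥0) := by
    intro t ht
    have := hP n t (hPn t ht)
    have hmeas : Measurable fun z => min M (L t z) := measurable_const.min (hL t)
    have hg : Measurable fun ω => ∫⁻ z, min M (L t z) ∂(τ ω) := hmeas.lintegral_kernel
    have hgM : ∀ ω, ∫⁻ z, min M (L t z) ∂(τ ω) ≤ M := fun ω =>
      (lintegral_mono fun z => min_le_left _ _).trans (by simp)
    calc ∫⁻ y, ∫⁻ z, min M (L t z) ∂((τ ∘ₖ K n) y) ∂(Q t)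
        = ∫⁻ ω, ∫⁻ z, min M (L t z) ∂(τ ω) ∂((Q t).bind (K n)) := by
          rw [Measure.lintegral_bind (K n).measurable.aemeasurable hg.aemeasurable]
          exact lintegral_congr fun y => Kernel.lintegral_comp _ _ _ hmeas
      _ ≤ ∫⁻ ω, ∫⁻ z, min M (L t z) ∂(τ ω) ∂(P n t)
            + M * ENNReal.ofReal (tvDist ((Q t).bind (K n)) (P n t)) :=
          lintegral_le_add_mul_tvDist _ _ hg hM0.ne' hMtop hgM
      _ ≤ _ := by
          refine add_le_add (le_iSup₂_of_le t ht le_rfl) (le_trans ?_ hn.le)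
          gcongr
          exact S.le_real_biSup (fun t => tvDist ((Q t).bind (K n)) (P n t)) ht
  have hrisk := hδlt.le.trans <| (iInf_le _ ⟨τ ∘ₖ K n, inferInstance⟩).trans (iSup₂_le hcomp)
  have hsplit : (δ : ℝ≥0∞) = (δ / 2 : ℝ≥0) + (δ / 2 : ℝ≥0) := by
    rw [← ENNReal.coe_add, add_halves]
  rw [hsplit, ← add_assoc] at hrisk
  exact (ENNReal.add_le_add_iff_right ENNReal.coe_ne_top).1 hrisk
end
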